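/- arXiv:1109.2823 — 2 statements merged into one kernel-verified Lean document; each statement's English description precedes it below -/
import Mathlib

section
/- Let X be a first countable, locally compact, paracompact Hausdorff topological space, f : X → X a topologically Anosov homeomorphism, and R a chain component of f. Then the restriction f|_R : R → R is topologically transitive: for any nonempty relatively open sets G, H ⊆ R there exists n ∈ ℕ with f^n(G) ∩ H ≠ ∅. -/
open Set Topology

namespace TopAnosovPaper

variable {X Y : Type*}

section Defs

variable [TopologicalSpace X]

/-- The `n`-th iterate (n ∈ ℤ) of a homeomorphism, as a function. -/
def iter (f : X ≃ₜ X) (n : ℤ) : X → X := ⇑(f.toEquiv ^ n)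

/-- `N` is an expansive neighborhood for `f`: a closed neighborhood of the
diagonal such that any two distinct points are eventually separated by `F = f × f`. -/
def IsExpansiveNbhd (f : X ≃ₜ X) (N : Set (X × X)) : Prop :=
  IsClosed N ∧ N ∈ nhdsSet (Set.diagonal X) ∧
    ∀ x y : X, x ≠ y → ∃ n : ℤ, (iter f n x, iter f n y) ∉ N

/-- `f` is topologically expansive. -/
def TopExpansive (f : X ≃ₜ X) : Prop := ∃ N : Set (X × X), IsExpansiveNbhd f N

/-- A `D`-pseudo-orbit: a bi-infinite sequence with `(f x_{i-1}, x_i) ∈ D`. -/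
def IsPseudoOrbit (f : X ≃ₜ X) (D : Set (X × X)) (x : ℤ → X) : Prop :=
  ∀ i : ℤ, (f (x (i - 1)), x i) ∈ D

/-- `y` `E`-traces the bi-infinite sequence `x`. -/
def Traces (f : X ≃ₜ X) (E : Set (X × X)) (y : X) (x : ℤ → X) : Prop :=
  ∀ i : ℤ, (iter f i y, x i) ∈ E

/-- `f` has the topological shadowing property. -/
def TopShadowing (f : X ≃ₜ X) : Prop :=
  ∀ E ∈ nhdsSet (Set.diagonal X), ∃ D ∈ nhdsSet (Set.diagonal X),
    ∀ x : ℤ → X, IsPseudoOrbit f D x → ∃ y : X, Traces f E y x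

/-- `f` is topologically Anosov: expansive with the shadowing property. -/
def TopAnosov (f : X ≃ₜ X) : Prop := TopExpansive f ∧ TopShadowing f

/-- An `A`-chain from `x` to `y` (of length `n ≥ 1`). -/
def IsChainFromTo (f : X ≃ₜ X) (A : Set (X × X)) (x y : X) : Prop :=
  ∃ n : ℕ, 1 ≤ n ∧ ∃ c : ℕ → X, c 0 = x ∧ c n = y ∧
    ∀ i : ℕ, 1 ≤ i → i ≤ n → (f (c (i - 1)), c i) ∈ A

/-- `x ∼ y`: for every neighborhood `A` of the diagonal there is an `A`-chain
from `x` to `y` and one from `y` to `x`. -/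
def ChainRel (f : X ≃ₜ X) (x y : X) : Prop :=
  ∀ A ∈ nhdsSet (Set.diagonal X), IsChainFromTo f A x y ∧ IsChainFromTo f A y x

/-- The chain recurrent set. -/
def CR (f : X ≃ₜ X) : Set X := {x | ChainRel f x x}

/-- `R` is a chain component: an equivalence class of `∼` restricted to `CR f`. -/
def IsChainComponent (f : X ≃ₜ X) (R : Set X) : Prop :=
  ∃ x ∈ CR f, R = {y | y ∈ CR f ∧ ChainRel f x y}

/-- The non-wandering set of `f`. -/
def NonWandering (f : X ≃ₜ X) : Set X :=
  {x | ∀ G : Set X, IsOpen G → x ∈ G → ∃ n : ℕ, 0 < n ∧ (iter f n '' G ∩ G).Nonempty}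

/-- `x` is a periodic point of `f`. -/
def Periodic (f : X ≃ₜ X) (x : X) : Prop := ∃ n : ℕ, 0 < n ∧ iter f n x = x

/-- The set of periodic points of `f`. -/
def Per (f : X ≃ₜ X) : Set X := {x | Periodic f x}

/-- A relation `M ⊆ X × X` is proper if `M[S]` is compact for every compact `S`. -/
def IsProperRel (M : Set (X × X)) : Prop :=
  ∀ S : Set X, IsCompact S → IsCompact {y : X | ∃ x ∈ S, (x, y) ∈ M}

/-- A set `U ⊆ X × X` is wide if `U ∪ (S × X) = X × X` for some compact `S`. -/
def IsWide (U : Set (X × X)) : Prop :=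
  ∃ S : Set X, IsCompact S ∧ U ∪ (S ×ˢ (Set.univ : Set X)) = Set.univ

/-- `E` is symmetric. -/
def SymmRel (E : Set (X × X)) : Prop := ∀ p : X × X, p ∈ E → (p.2, p.1) ∈ E

/-- `E² = {(x,y) : ∃ z, (x,z) ∈ E ∧ (z,y) ∈ E}`. -/
def sq (E : Set (X × X)) : Set (X × X) := {p : X × X | ∃ z : X, (p.1, z) ∈ E ∧ (z, p.2) ∈ E}

/-- The local stable set of `x` relative to `B`. -/
def WsLoc (f : X ≃ₜ X) (B : Set (X × X)) (x : X) : Set X :=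
  {y | ∀ i : ℤ, 0 ≤ i → (iter f i x, iter f i y) ∈ B}

/-- The local unstable set of `x` relative to `B`. -/
def WuLoc (f : X ≃ₜ X) (B : Set (X × X)) (x : X) : Set X :=
  {y | ∀ i : ℤ, i ≤ 0 → (iter f i x, iter f i y) ∈ B}

/-- The stable set of `x`. -/
def Ws (f : X ≃ₜ X) (x : X) : Set X :=
  {y | ∀ B ∈ nhdsSet (Set.diagonal X), ∃ n : ℕ, ∀ i : ℤ, (n : ℤ) ≤ i →
    (iter f i x, iter f i y) ∈ B}

/-- The unstable set of `x`. -/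
def Wu (f : X ≃ₜ X) (x : X) : Set X :=
  {y | ∀ B ∈ nhdsSet (Set.diagonal X), ∃ n : ℕ, ∀ i : ℤ, i ≤ -(n : ℤ) →
    (iter f i x, iter f i y) ∈ B}

/-- `f` restricted to `R` is topologically transitive: for any nonempty
relatively open subsets `G, H` of `R` there is `n ∈ ℕ` with `f^n(G) ∩ H ≠ ∅`. -/
def TransitiveOn (f : X ≃ₜ X) (R : Set X) : Prop :=
  ∀ G H : Set X, (∃ U : Set X, IsOpen U ∧ G = U ∩ R) → (∃ V : Set X, IsOpen V ∧ H = V ∩ R) →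
    G.Nonempty → H.Nonempty → ∃ n : ℕ, (iter f n '' G ∩ H).Nonempty

/-- `V_N(A)`: pairs whose first `N` forward and backward iterates all lie in `A`. -/
def VN (f : X ≃ₜ X) (A : Set (X × X)) (N : ℕ) : Set (X × X) :=
  {p : X × X | ∀ n : ℤ, |n| ≤ (N : ℤ) → (iter f n p.1, iter f n p.2) ∈ A}

/-- The `n`-th power (n ∈ ℕ) of a homeomorphism. -/
def hpowNat (f : X ≃ₜ X) : ℕ → X ≃ₜ X
  | 0 => Homeomorph.refl X
  | n + 1 => (hpowNat f n).trans f

/-- The `k`-th power (k ∈ ℤ) of a homeomorphism, as a homeomorphism. -/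
def hpow (f : X ≃ₜ X) : ℤ → X ≃ₜ X
  | Int.ofNat n => hpowNat f n
  | Int.negSucc n => (hpowNat f (n + 1)).symm

end Defs

end TopAnosovPaper

open TopAnosovPaper

namespace TopAnosovPaper

open Filter

section Entourages

variable {X : Type*} [TopologicalSpace X]

/-- In a paracompact Hausdorff space every open cover is refined by the sections of a symmetric
neighborhood of the diagonal. -/
lemma exists_symm_nhdsSet_diagonal_subordinate [ParacompactSpace X] [T2Space X] {ι : Type*}
    (U : ι → Set X) (hU : ∀ i, IsOpen (U i)) (hcov : ⋃ i, U i = univ) :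
    ∃ E ∈ nhdsSet (diagonal X), SymmRel E ∧ ∀ y, ∃ i, ∀ a, (a, y) ∈ E → a ∈ U i := by
  obtain ⟨V, hVo, hVc, hVf, hVU⟩ := precise_refinement U hU hcov
  obtain ⟨C, hCc, hCcl, hCV⟩ := exists_iUnion_eq_closed_subset hVo hVf.point_finite hVc
  refine ⟨⋂ i, (V i ×ˢ V i ∪ (C i)ᶜ ×ˢ (C i)ᶜ), ?_, ?_, ?_⟩
  · rw [mem_nhdsSet_iff_forall]
    rintro ⟨x, _⟩ (rfl : x = _)
    obtain ⟨W, hW, hfin⟩ := hVf x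
    have h1 : (⋂ i ∈ {i | (V i ∩ W).Nonempty}, (V i ×ˢ V i ∪ (C i)ᶜ ×ˢ (C i)ᶜ)) ∈ 𝓝 (x, x) := by
      rw [biInter_mem hfin]
      intro i _
      refine IsOpen.mem_nhds (((hVo i).prod (hVo i)).union
        ((hCcl i).isOpen_compl.prod (hCcl i).isOpen_compl)) ?_
      by_cases hx : x ∈ C i
      · exact Or.inl ⟨hCV i hx, hCV i hx⟩
      · exact Or.inr ⟨hx, hx⟩
    filter_upwards [h1, prod_mem_nhds hW hW] with q hq hqW
    refine mem_iInter.2 fun i => ?_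
    by_cases hi : (V i ∩ W).Nonempty
    · exact mem_iInter₂.1 hq i hi
    · exact Or.inr ⟨fun h => hi ⟨_, hCV i h, hqW.1⟩, fun h => hi ⟨_, hCV i h, hqW.2⟩⟩
  · intro q hq
    refine mem_iInter.2 fun i => ?_
    rcases mem_iInter.1 hq i with h | h
    · exact Or.inl ⟨h.2, h.1⟩
    · exact Or.inr ⟨h.2, h.1⟩
  · intro y
    obtain ⟨i, hi⟩ := mem_iUnion.1 (hCc.symm ▸ mem_univ y : y ∈ ⋃ i, C i)
    refine ⟨i, fun a ha => hVU i ?_⟩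
    rcases mem_iInter.1 ha i with h | h
    · exact h.1
    · exact absurd hi h.2

/-- In a paracompact Hausdorff space the neighborhoods of the diagonal can be halved. -/
lemma exists_symm_comp_subset [ParacompactSpace X] [T2Space X] {A : Set (X × X)}
    (hA : A ∈ nhdsSet (diagonal X)) :
    ∃ E ∈ nhdsSet (diagonal X), SymmRel E ∧ ∀ a b c, (a, b) ∈ E → (b, c) ∈ E → (a, c) ∈ A := by
  have h : ∀ x : X, ∃ U : Set X, IsOpen U ∧ x ∈ U ∧ U ×ˢ U ⊆ A := fun x => by
    obtain ⟨U, hU, hx, hUA⟩ :=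
      exists_nhds_square (mem_nhdsSet_iff_forall.1 hA (x, x) rfl)
    exact ⟨U, hU, hx, hUA⟩
  choose U hUo hxU hUA using h
  obtain ⟨E, hE, hs, hEU⟩ := exists_symm_nhdsSet_diagonal_subordinate U hUo
    (eq_univ_of_forall fun x => mem_iUnion.2 ⟨x, hxU x⟩)
  refine ⟨E, hE, hs, fun a b c hab hbc => ?_⟩
  obtain ⟨i, hi⟩ := hEU b
  exact hUA i ⟨hi a hab, hi c (hs _ hbc)⟩

/-- A locally compact paracompact Hausdorff space has a symmetric neighborhood of the diagonal
whose sections are relatively compact. -/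
lemma exists_symm_relatively_compact_sections [LocallyCompactSpace X] [ParacompactSpace X]
    [T2Space X] :
    ∃ E ∈ nhdsSet (diagonal X), SymmRel E ∧
      ∀ y, ∃ K, IsCompact K ∧ ∀ a, (a, y) ∈ E → a ∈ K := by
  choose K hK hxK using fun x : X => exists_compact_mem_nhds x
  obtain ⟨E, hE, hs, hEU⟩ := exists_symm_nhdsSet_diagonal_subordinate
    (fun x => interior (K x)) (fun _ => isOpen_interior)
    (eq_univ_of_forall fun x => mem_iUnion.2 ⟨x, mem_interior_iff_mem_nhds.2 (hxK x)⟩)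
  refine ⟨E, hE, hs, fun y => ?_⟩
  obtain ⟨i, hi⟩ := hEU y
  exact ⟨K i, hK i, fun a ha => interior_subset (hi a ha)⟩

/-- The pairs whose first entry lies in a given neighborhood of `x` whenever the second is `x`
form a neighborhood of the diagonal. -/
lemma nhds_section_mem_nhdsSet_diagonal [T1Space X] {x : X} {U : Set X} (hU : U ∈ 𝓝 x) :
    {q : X × X | q.2 = x → q.1 ∈ U} ∈ nhdsSet (diagonal X) := by
  rw [mem_nhdsSet_iff_forall]
  rintro ⟨a, _⟩ (rfl : a = _)
  by_cases h : a = x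
  · subst h
    filter_upwards [prod_mem_nhds hU univ_mem] with q hq _ using hq.1
  · filter_upwards [prod_mem_nhds univ_mem (isOpen_compl_singleton.mem_nhds h)] with q hq hx
      using absurd hx hq.2

lemma refl_mem_of_mem_nhdsSet_diagonal {A : Set (X × X)} (hA : A ∈ nhdsSet (diagonal X)) (x : X) :
    (x, x) ∈ A :=
  mem_of_mem_nhds (mem_nhdsSet_iff_forall.1 hA (x, x) rfl)

end Entourages

section Iterates

variable {X : Type*} [TopologicalSpace X] (f : X ≃ₜ X)

lemma iter_zero (x : X) : iter f 0 x = x := by simp [iter]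

lemma iter_add (m n : ℤ) (x : X) : iter f (m + n) x = iter f m (iter f n x) := by
  simp [iter, zpow_add]

lemma iter_one (x : X) : iter f 1 x = f x := by simp [iter]

lemma apply_iter (n : ℤ) (x : X) : f (iter f n x) = iter f (n + 1) x := by
  rw [add_comm, iter_add, iter_one]

lemma continuous_iter (n : ℤ) : Continuous (iter f n) := by
  have h : ∀ k : ℕ, Continuous (iter f k) ∧ Continuous (iter f (-k)) := by
    intro k
    induction k with
    | zero =>
      have : iter f 0 = id := funext (iter_zero f)
      simp [this, continuous_id]
    | succ k ih =>
      constructor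
      · have : iter f ((k + 1 : ℕ) : ℤ) = f ∘ iter f k := funext fun x => by
          simp [apply_iter]
        rw [this]
        exact f.continuous.comp ih.1
      · have : iter f (-((k + 1 : ℕ) : ℤ)) = f.symm ∘ iter f (-k) := funext fun x => by
          rw [Function.comp_apply, Homeomorph.eq_symm_apply, apply_iter]
          congr 1
          push_cast
          ring
        rw [this]
        exact f.symm.continuous.comp ih.2
  obtain ⟨k, rfl | rfl⟩ := n.eq_nat_or_neg
  exacts [(h k).1, (h k).2]

variable {f}

lemma iter_mul_of_iter_eq {p : ℤ} {z : X} (hz : iter f p z = z) (k : ℤ) :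
    iter f (p * k) z = z := by
  have : f.toEquiv ^ p • z = z := hz
  simpa [iter, zpow_mul, Function.IsFixedPt] using Function.IsFixedPt.perm_zpow (e := f.toEquiv ^ p) hz k

end Iterates

section Chains

variable {X : Type*} [TopologicalSpace X] {f : X ≃ₜ X}

lemma isChainFromTo_iff_transGen {A : Set (X × X)} {x y : X} :
    IsChainFromTo f A x y ↔ Relation.TransGen (fun a b => (f a, b) ∈ A) x y := by
  constructor
  · rintro ⟨n, hn, c, rfl, rfl, hc⟩
    induction n, hn using Nat.le_induction with
    | base => exact .single (hc 1 le_rfl le_rfl)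
    | succ n hn ih =>
      exact (ih fun i h1 h2 => hc i h1 (h2.trans n.le_succ)).tail
        (hc (n + 1) (by omega) le_rfl)
  · intro h
    induction h with
    | @single b h =>
      refine ⟨1, le_rfl, fun i => if i = 0 then x else b, by simp, by simp, fun i h1 h2 => ?_⟩
      obtain rfl : i = 1 := by omega
      simpa using h
    | @tail b d _ h ih =>
      obtain ⟨n, hn, c, h0, hcn, hc⟩ := ih
      refine ⟨n + 1, by omega, fun i => if i ≤ n then c i else d, by simp [h0], by simp, ?_⟩
      intro i h1 h2
      rcases h2.lt_or_eq with h3 | rfl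
      · have h4 : i ≤ n := by omega
        have h5 : i - 1 ≤ n := by omega
        simpa [h4, h5] using hc i h1 h4
      · simpa [hcn] using h

lemma ChainRel.trans {x y z : X} (h1 : ChainRel f x y) (h2 : ChainRel f y z) :
    ChainRel f x z := by
  intro A hA
  have a := h1 A hA
  have b := h2 A hA
  simp only [isChainFromTo_iff_transGen] at a b ⊢
  exact ⟨a.1.trans b.1, b.2.trans a.2⟩

lemma ChainRel.symm {x y : X} (h : ChainRel f x y) : ChainRel f y x :=
  fun A hA => (h A hA).symm

lemma transGen_iter {A : Set (X × X)} (hA : A ∈ nhdsSet (diagonal X)) (x : X) {a b : ℤ}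
    (hab : a < b) :
    Relation.TransGen (fun u v => (f u, v) ∈ A) (iter f a x) (iter f b x) := by
  have hstep : ∀ n : ℤ, (f (iter f n x), iter f (n + 1) x) ∈ A := fun n => by
    rw [apply_iter]
    exact refl_mem_of_mem_nhdsSet_diagonal hA _
  induction b, (show a + 1 ≤ b from hab) using Int.leInduction with
  | base => exact .single (hstep a)
  | succ n _ ih => exact (ih (by omega)).tail (hstep n)

/-- A periodic point is chain equivalent to every point of its orbit. -/
lemma chainRel_iter {p : ℤ} (hp : 0 < p) {z : X} (hz : iter f p z = z) (n : ℤ) :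
    ChainRel f z (iter f n z) := by
  intro A hA
  simp only [isChainFromTo_iff_transGen]
  have hn : |n| < p * (|n| + 1) := by nlinarith [abs_nonneg n]
  constructor
  · have h := transGen_iter (f := f) hA z (a := p * -(|n| + 1)) (b := n)
      (by linarith [neg_abs_le n])
    rwa [iter_mul_of_iter_eq hz] at h
  · have h := transGen_iter (f := f) hA z (a := n) (b := p * (|n| + 1))
      (by linarith [le_abs_self n])
    rwa [iter_mul_of_iter_eq hz] at h

end Chains

section Shadowing

variable {X : Type*} [TopologicalSpace X] {f : X ≃ₜ X}

/-- A point which stays close to a periodic orbit in the past or in the future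
accumulates at it. -/
lemma mapClusterPt_iter_of_expansive {N E : Set (X × X)} (hN : IsExpansiveNbhd f N)
    (hEN : E ⊆ N) {z w : X} {K : Set X} (hK : IsCompact K) (hzK : ∀ a, (a, z) ∈ E → a ∈ K)
    {p : ℤ} {l : Filter ℤ} [l.NeBot]
    (h : ∀ i : ℤ, ∀ᶠ k in l, (iter f (i + p * k) w, iter f i z) ∈ E) :
    MapClusterPt z l fun k => iter f (p * k) w := by
  have hmem : ∀ᶠ k in l, iter f (p * k) w ∈ K := by
    filter_upwards [h 0] with k hk
    exact hzK _ (by simpa [iter_zero] using hk)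
  obtain ⟨u, -, hu⟩ := hK.exists_mapClusterPt (tendsto_principal.2 hmem)
  suffices u = z from this ▸ hu
  by_contra hne
  obtain ⟨i, hi⟩ := hN.2.2 u z hne
  have hnhds : ∀ᶠ v in 𝓝 u, (iter f i v, iter f i z) ∉ N :=
    (hN.1.isOpen_compl.preimage
      ((continuous_iter f i).prodMk continuous_const)).mem_nhds hi
  obtain ⟨k, hk1, hk2⟩ := ((hu.frequently hnhds).and_eventually (h i)).exists
  rw [iter_add] at hk2
  exact hk1 (hEN hk2)

/-- Close periodic points are linked by arbitrarily fine chains. -/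
lemma isChainFromTo_of_periodic_of_close {N E D : Set (X × X)} (hN : IsExpansiveNbhd f N)
    (hEN : E ⊆ N) (hEK : ∀ y, ∃ K, IsCompact K ∧ ∀ a, (a, y) ∈ E → a ∈ K)
    (hD : D ∈ nhdsSet (diagonal X))
    (hDE : ∀ x : ℤ → X, IsPseudoOrbit f D x → ∃ y : X, Traces f E y x)
    {z z' : X} (hz : Periodic f z) (hz' : Periodic f z') (hzz : (z', z) ∈ D)
    {A : Set (X × X)} (hA : A ∈ nhdsSet (diagonal X)) : IsChainFromTo f A z' z := by
  obtain ⟨p, hp, hz⟩ := hz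
  obtain ⟨p', hp', hz'⟩ := hz'
  have hps : IsPseudoOrbit f D fun i => if 0 ≤ i then iter f i z else iter f i z' := by
    intro i
    simp only [apply_ite f, apply_iter, sub_add_cancel]
    rcases lt_trichotomy i 0 with hi | rfl | hi
    · rw [if_neg (by omega), if_neg (by omega)]
      exact refl_mem_of_mem_nhdsSet_diagonal hD _
    · simpa [iter_zero] using hzz
    · rw [if_pos (by omega), if_pos (by omega)]
      exact refl_mem_of_mem_nhdsSet_diagonal hD _
  obtain ⟨w, hw⟩ := hDE _ hps
  obtain ⟨K, hK, hzK⟩ := hEK z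
  obtain ⟨K', hK', hzK'⟩ := hEK z'
  have h1 : MapClusterPt z atTop fun k => iter f (p * k) w := by
    refine mapClusterPt_iter_of_expansive hN hEN hK hzK fun i => ?_
    filter_upwards [eventually_ge_atTop |i|] with k hk
    have h := hw (i + p * k)
    have hpk : k ≤ p * k := le_mul_of_one_le_left ((abs_nonneg i).trans hk) (by omega)
    beta_reduce at h
    rw [if_pos (by linarith [neg_abs_le i])] at h
    rwa [iter_add f i (p * k) z, iter_mul_of_iter_eq hz] at h
  have h2 : MapClusterPt z' atBot fun k => iter f (p' * k) w := by
    refine mapClusterPt_iter_of_expansive hN hEN hK' hzK' fun i => ?_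
    filter_upwards [eventually_le_atBot (-(|i| + 1))] with k hk
    have h := hw (i + p' * k)
    have hpk : p' * k ≤ k := by nlinarith [abs_nonneg i, (by omega : (1 : ℤ) ≤ p')]
    beta_reduce at h
    rw [if_neg (by linarith [le_abs_self i])] at h
    rwa [iter_add f i (p' * k) z', iter_mul_of_iter_eq hz'] at h
  have hA' := mem_nhdsSet_iff_forall.1 hA
  have n1 : ∀ᶠ v in 𝓝 z, (v, z) ∈ A :=
    (Continuous.prodMk_left z).continuousAt (hA' (z, z) rfl)
  have n2 : ∀ᶠ v in 𝓝 z', (f z', f v) ∈ A :=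
    (continuous_const.prodMk f.continuous).continuousAt (hA' (f z', f z') rfl)
  obtain ⟨k, hk1, hk⟩ := ((h1.frequently n1).and_eventually (eventually_ge_atTop 3)).exists
  obtain ⟨j, hj1, hj⟩ := ((h2.frequently n2).and_eventually (eventually_le_atBot 0)).exists
  rw [isChainFromTo_iff_transGen]
  rw [apply_iter] at hj1
  have hlast : (f (iter f (p * k - 1) w), z) ∈ A := by simpa [apply_iter] using hk1
  refine .head hj1 (.tail (transGen_iter hA w ?_) hlast)
  nlinarith [(by omega : (1 : ℤ) ≤ p), (by omega : (1 : ℤ) ≤ p')]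

/-- A pair of chains in opposite directions extends to a periodic pseudo-orbit. -/
lemma exists_periodic_isPseudoOrbit {D : Set (X × X)} {x y : X} (hxy : IsChainFromTo f D x y)
    (hyx : IsChainFromTo f D y x) :
    ∃ (s : ℤ → X) (m p : ℕ), 0 < p ∧ IsPseudoOrbit f D s ∧ s 0 = x ∧ s m = y ∧
      ∀ i, s (i + p) = s i := by
  obtain ⟨n, hn, c, hc0, hcn, hc⟩ := hxy
  obtain ⟨m, hm, d, hd0, hdm, hd⟩ := hyx
  set e : ℕ → X := fun i => if i ≤ n then c i else d (i - n) with he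
  have e0 : e 0 = x := by simp [he, hc0]
  have en : e n = y := by simp [he, hcn]
  have ep : e (n + m) = x := by
    have : ¬ n + m ≤ n := by omega
    simp [he, this, hdm]
  have hestep : ∀ i, i < n + m → (f (e i), e (i + 1)) ∈ D := by
    intro i hi
    rcases lt_trichotomy i n with h | rfl | h
    · have := hc (i + 1) (by omega) (by omega)
      simpa [he, h.le, Nat.succ_le_of_lt h] using this
    · have := hd 1 le_rfl hm
      simpa [he, hcn, hd0] using this
    · have := hd (i - n + 1) (by omega) (by omega)
      have h1 : ¬ i ≤ n := by omega
      have h2 : ¬ i + 1 ≤ n := by omega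
      have h3 : i + 1 - n = i - n + 1 := by omega
      simpa [he, h1, h2, h3] using this
  refine ⟨fun i => e (i % ((n + m : ℕ) : ℤ)).toNat, n, n + m, by omega, fun i => ?_, by simp [e0],
    ?_, fun i => by simp⟩
  · have hpos : (0 : ℤ) < ((n + m : ℕ) : ℤ) := by omega
    have h1 := Int.emod_nonneg (i - 1) hpos.ne'
    have h2 := Int.emod_lt_of_pos (i - 1) hpos
    have h3 : i % ((n + m : ℕ) : ℤ) = ((i - 1) % ((n + m : ℕ) : ℤ) + 1) % ((n + m : ℕ) : ℤ) := by
      rw [Int.emod_add_emod, sub_add_cancel]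
    obtain ⟨r, hr⟩ := Int.eq_ofNat_of_zero_le h1
    simp only [h3, hr]
    rw [hr] at h2
    have h4 := hestep r (by exact_mod_cast h2)
    rcases (show r + 1 ≤ n + m by omega).lt_or_eq with h | h
    · rwa [Int.emod_eq_of_lt (by omega) (by omega), Int.toNat_natCast, Int.toNat_natCast_add_one]
    · rw [h, ep, ← e0] at h4
      have : ((r : ℤ) + 1) = ((n + m : ℕ) : ℤ) := by omega
      rwa [this, Int.emod_self, Int.toNat_natCast, Int.toNat_zero]
  · have : (n : ℤ) % ((n + m : ℕ) : ℤ) = n := Int.emod_eq_of_lt (by omega) (by omega)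
    simp only [this, Int.toNat_natCast, en]

/-- Chain equivalent points are simultaneously approximated by a single periodic orbit. -/
lemma exists_periodic_close {N E : Set (X × X)} (hN : IsExpansiveNbhd f N)
    (hEN : ∀ a b c, (a, b) ∈ E → (c, b) ∈ E → (a, c) ∈ N)
    (hf : TopShadowing f) {B : Set (X × X)} (hB : B ∈ nhdsSet (diagonal X)) (hBE : B ⊆ E)
    {x y : X} (hxy : ChainRel f x y) :
    ∃ z, Periodic f z ∧ (z, x) ∈ B ∧ ∃ m : ℕ, (iter f m z, y) ∈ B := by
  obtain ⟨D, hD, hDB⟩ := hf B hB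
  obtain ⟨s, m, p, hp, hs, hs0, hsm, hper⟩ :=
    exists_periodic_isPseudoOrbit (hxy D hD).1 (hxy D hD).2
  obtain ⟨z, hz⟩ := hDB s hs
  refine ⟨z, ⟨p, hp, ?_⟩, ?_, m, hsm ▸ hz m⟩
  · by_contra hne
    obtain ⟨i, hi⟩ := hN.2.2 _ _ hne
    refine hi (hEN _ (s i) _ (hBE ?_) (hBE (hz i)))
    rw [← iter_add, ← hper i]
    exact hz _
  · simpa [iter_zero, hs0] using hz 0

/-- Periodic points close to a chain recurrent point are chain equivalent to it. -/
lemma chainRel_of_periodic_of_close [ParacompactSpace X] [T2Space X] {N E D D' : Set (X × X)}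
    (hN : IsExpansiveNbhd f N) (hE : E ∈ nhdsSet (diagonal X))
    (hEN : ∀ a b c, (a, b) ∈ E → (c, b) ∈ E → (a, c) ∈ N)
    (hEK : ∀ y, ∃ K, IsCompact K ∧ ∀ a, (a, y) ∈ E → a ∈ K) (hf : TopShadowing f)
    (hD : D ∈ nhdsSet (diagonal X))
    (hDE : ∀ x : ℤ → X, IsPseudoOrbit f D x → ∃ y : X, Traces f E y x)
    (hD' : D' ∈ nhdsSet (diagonal X)) (hDs : SymmRel D')
    (hDD : ∀ a b c, (a, b) ∈ D' → (b, c) ∈ D' → (a, c) ∈ D)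
    {x z : X} (hx : ChainRel f x x) (hz : Periodic f z) (hzx : (z, x) ∈ D') :
    ChainRel f x z := by
  have hEN' : E ⊆ N := fun q hq => hEN q.1 q.2 q.2 hq (refl_mem_of_mem_nhdsSet_diagonal hE _)
  intro A hA
  obtain ⟨B, hB, hBs, hBA⟩ := exists_symm_comp_subset hA
  have hfx : {v | (f v, f x) ∈ B} ∈ 𝓝 x :=
    (f.continuous.prodMk continuous_const).continuousAt
      (mem_nhdsSet_iff_forall.1 hB (f x, f x) rfl)
  obtain ⟨z', hz', ⟨⟨⟨-, h1⟩, h2⟩, h3⟩, -⟩ := exists_periodic_close hN hEN hf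
    (inter_mem (inter_mem (inter_mem hE hD') hB) (nhds_section_mem_nhdsSet_diagonal hfx))
    (fun _ hq => hq.1.1.1) hx
  have c1 := isChainFromTo_of_periodic_of_close hN hEN' hEK hD hDE hz hz'
    (hDD _ _ _ h1 (hDs _ hzx)) hB
  have c2 := isChainFromTo_of_periodic_of_close hN hEN' hEK hD hDE hz' hz
    (hDD _ _ _ hzx (hDs _ h1)) hB
  have hBA' : ∀ a b, (f a, b) ∈ B → (f a, b) ∈ A := fun a b h =>
    hBA _ _ _ h (refl_mem_of_mem_nhdsSet_diagonal hB _)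
  rw [isChainFromTo_iff_transGen] at c1 c2 ⊢
  rw [isChainFromTo_iff_transGen]
  constructor
  · obtain ⟨b, hb, hbz⟩ := Relation.TransGen.head'_iff.1 c1
    exact .head' (hBA _ _ _ (hBs _ (h3 rfl)) hb) (Relation.ReflTransGen.mono hBA' _ _ hbz)
  · obtain ⟨b, hzb, hb⟩ := Relation.TransGen.tail'_iff.1 c2
    exact .tail' (Relation.ReflTransGen.mono hBA' _ _ hzb) (hBA _ _ _ hb h2)

end Shadowing

end TopAnosovPaper

/-- A topologically Anosov homeomorphism is topologically transitive on
each chain component. -/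
theorem transitive_on_component {X : Type*} [TopologicalSpace X]
    [FirstCountableTopology X] [LocallyCompactSpace X] [ParacompactSpace X] [T2Space X]
    (f : X ≃ₜ X) (hf : TopAnosov f) (R : Set X) (hR : IsChainComponent f R) :
    TransitiveOn f R := by
  obtain ⟨⟨N, hN⟩, hsh⟩ := hf
  obtain ⟨r, -, rfl⟩ := hR
  rintro _ _ ⟨U, hU, rfl⟩ ⟨V, hV, rfl⟩ ⟨x, hxU, hx, hrx⟩ ⟨y, hyV, -, hry⟩
  obtain ⟨E₁, hE₁, hE₁s, hE₁N⟩ := exists_symm_comp_subset hN.2.1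
  obtain ⟨E₂, hE₂, -, hE₂K⟩ := exists_symm_relatively_compact_sections (X := X)
  have hE : E₁ ∩ E₂ ∈ nhdsSet (diagonal X) := Filter.inter_mem hE₁ hE₂
  have hEN : ∀ a b c, (a, b) ∈ E₁ ∩ E₂ → (c, b) ∈ E₁ ∩ E₂ → (a, c) ∈ N :=
    fun a b c h1 h2 => hE₁N a b c h1.1 (hE₁s _ h2.1)
  have hEK : ∀ y, ∃ K, IsCompact K ∧ ∀ a, (a, y) ∈ E₁ ∩ E₂ → a ∈ K := fun y => by
    obtain ⟨K, hK, h⟩ := hE₂K y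
    exact ⟨K, hK, fun a ha => h a ha.2⟩
  obtain ⟨D, hD, hDE⟩ := hsh _ hE
  obtain ⟨D', hD', hDs, hDD⟩ := exists_symm_comp_subset hD
  obtain ⟨z, hz, ⟨⟨⟨-, hzx⟩, hzU⟩, -⟩, m, ⟨-, hzV⟩⟩ := exists_periodic_close hN hEN hsh
    (Filter.inter_mem (Filter.inter_mem (Filter.inter_mem hE hD')
      (nhds_section_mem_nhdsSet_diagonal (hU.mem_nhds hxU)))
      (nhds_section_mem_nhdsSet_diagonal (hV.mem_nhds hyV)))
    (fun _ hq => hq.1.1.1) (hrx.symm.trans hry)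
  have hxz : ChainRel f x z :=
    chainRel_of_periodic_of_close hN hE hEN hEK hsh hD hDE hD' hDs hDD hx hz hzx
  obtain ⟨p, hp, hpz⟩ := hz
  have hzm : ChainRel f z (iter f m z) := chainRel_iter (by exact_mod_cast hp) hpz m
  exact ⟨m, iter f m z, ⟨z, ⟨hzU rfl, hxz.symm.trans hxz, hrx.trans hxz⟩, rfl⟩, hzV rfl,
    hzm.symm.trans hzm, (hrx.trans hxz).trans hzm⟩
end

section
/- Let (X,d) be a metric space and f : X → X a homeomorphism. Then a point x ∈ X is strongly chain recurrent if and only if it is topologically chain recurrent; that is, for every continuous function δ : X → (0,∞) there is a δ-chain from x to itself if and only if for every neighborhood A of Δ_X (in X × X with the product topology) there is an A-chain from x to itself. -/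
open Set Topology

open TopAnosovPaper

/-- Every neighborhood of the diagonal of a metric space contains a set
`{(z, w) | dist z w < δ z}` with `δ` continuous and positive. -/
theorem exists_continuous_pos_of_mem_nhdsSet_diagonal {X : Type*} [MetricSpace X]
    {A : Set (X × X)} (hA : A ∈ nhdsSet (Set.diagonal X)) :
    ∃ δ : X → ℝ, Continuous δ ∧ (∀ z, 0 < δ z) ∧ ∀ z w, dist z w < δ z → (z, w) ∈ A := by
  obtain ⟨U, hU, hdU, hUA⟩ := mem_nhdsSet_iff_exists.1 hA
  rcases Set.eq_empty_or_nonempty Uᶜ with h | h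
  · rw [Set.compl_empty_iff] at h
    exact ⟨fun _ => 1, continuous_const, fun _ => one_pos, fun z w _ => hUA (h ▸ mem_univ _)⟩
  · refine ⟨fun z => Metric.infDist (z, z) Uᶜ,
      (Metric.continuous_infDist_pt _).comp (continuous_id.prodMk continuous_id), fun z => ?_,
      fun z w hzw => hUA ?_⟩
    · exact (hU.isClosed_compl.notMem_iff_infDist_pos h).1 fun hz => hz (hdU rfl)
    · by_contra hw
      have hle : Metric.infDist (z, z) Uᶜ ≤ dist (z, z) (z, w) := Metric.infDist_le_dist_of_mem hw
      rw [Prod.dist_eq, dist_self, max_eq_right dist_nonneg] at hle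
      exact absurd hzw hle.not_gt

/-- The set `{(z, w) | dist z w < δ z}` is a neighborhood of the diagonal. -/
theorem setOf_dist_lt_mem_nhdsSet_diagonal {X : Type*} [MetricSpace X] {δ : X → ℝ}
    (hδ : Continuous δ) (hpos : ∀ z, 0 < δ z) :
    {p : X × X | dist p.1 p.2 < δ p.1} ∈ nhdsSet (Set.diagonal X) := by
  refine (isOpen_lt continuous_dist (hδ.comp continuous_fst)).mem_nhdsSet.2 ?_
  rintro ⟨z, w⟩ hzw
  obtain rfl : z = w := hzw
  simpa using hpos z

/-- In a metric space, a point is strongly chain recurrent iff it is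
topologically chain recurrent. -/
theorem strong_iff_top_chain_recurrent {X : Type*} [MetricSpace X] (f : X ≃ₜ X) (x : X) :
    (∀ δ : X → ℝ, Continuous δ → (∀ z : X, 0 < δ z) →
      ∃ n : ℕ, 1 ≤ n ∧ ∃ c : ℕ → X, c 0 = x ∧ c n = x ∧
        ∀ i : ℕ, 1 ≤ i → i ≤ n →
          dist (f (c (i - 1))) (c i) < δ (f (c (i - 1)))) ↔
    (∀ A ∈ nhdsSet (Set.diagonal X), IsChainFromTo f A x x) := by
  constructor
  · intro h A hA
    obtain ⟨δ, hδ, hpos, hsub⟩ := exists_continuous_pos_of_mem_nhdsSet_diagonal hA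
    obtain ⟨n, hn, c, h0, hc, hstep⟩ := h δ hδ hpos
    exact ⟨n, hn, c, h0, hc, fun i hi hin => hsub _ _ (hstep i hi hin)⟩
  · intro h δ hδ hpos
    exact h _ (setOf_dist_lt_mem_nhdsSet_diagonal hδ hpos)
end
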